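/- arXiv:0912.4624 — 6 statements merged into one kernel-verified Lean document; each statement's English description precedes it below -/
import Mathlib

section
/- Let 𝔄 and 𝒜 be Banach algebras such that 𝒜 is a Banach 𝔄-bimodule with compatible actions. If 𝔄 has an identity for 𝒜, i.e. there exists 𝔢 ∈ 𝔄 with 𝔢·a = a·𝔢 = a for every a ∈ 𝒜, then super-amenability of 𝒜 implies that 𝒜 is module super-amenable as an 𝔄-module. -/
open scoped BigOperators

/-- Compatible bimodule actions of a Banach algebra `R` on a Banach algebra `A`:
`l α a` is `α · a` and `r α a` is `a · α`. -/
structure AlgebraActions (R A : Type*) [NormedRing R] [NormedAlgebra ℂ R]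
    [NormedRing A] [NormedAlgebra ℂ A] where
  l : R →L[ℂ] A →L[ℂ] A
  r : R →L[ℂ] A →L[ℂ] A
  l_mul_l : ∀ α β a, l (α * β) a = l α (l β a)
  r_mul_r : ∀ α β a, r β (r α a) = r (α * β) a
  l_r : ∀ α β a, r β (l α a) = l α (r β a)
  compat_left : ∀ α a b, l α (a * b) = l α a * b
  compat_right : ∀ α a b, r α (a * b) = a * r α b

/-- The data of a Banach `A`-`R`-module `X`: bimodule actions of `A` and of `R`
on `X` which are compatible with each other and with the given actions of `R` on `A`.
Here `al a x = a · x`, `ar a x = x · a`, `rl α x = α · x`, `rr α x = x · α`. -/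
structure ModuleActions (R A X : Type*) [NormedRing R] [NormedAlgebra ℂ R]
    [NormedRing A] [NormedAlgebra ℂ A] [NormedAddCommGroup X] [NormedSpace ℂ X]
    (act : AlgebraActions R A) where
  al : A →L[ℂ] X →L[ℂ] X
  ar : A →L[ℂ] X →L[ℂ] X
  rl : R →L[ℂ] X →L[ℂ] X
  rr : R →L[ℂ] X →L[ℂ] X
  al_mul : ∀ a b x, al (a * b) x = al a (al b x)
  ar_mul : ∀ a b x, ar b (ar a x) = ar (a * b) x
  al_ar : ∀ a b x, ar b (al a x) = al a (ar b x)
  rl_mul : ∀ α β x, rl (α * β) x = rl α (rl β x)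
  rr_mul : ∀ α β x, rr β (rr α x) = rr (α * β) x
  rl_rr : ∀ α β x, rr β (rl α x) = rl α (rr β x)
  compat1 : ∀ α a x, rl α (al a x) = al (act.l α a) x  -- α·(a·x) = (α·a)·x
  compat2 : ∀ a α x, al a (rl α x) = al (act.r α a) x  -- a·(α·x) = (a·α)·x
  compat3 : ∀ α a x, ar a (rl α x) = rl α (ar a x)     -- (α·x)·a = α·(x·a)
  compat4 : ∀ a α x, rr α (ar a x) = ar (act.r α a) x  -- (x·a)·α = x·(a·α)
  compat5 : ∀ α a x, ar a (rr α x) = ar (act.l α a) x  -- (x·α)·a = x·(α·a)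
  compat6 : ∀ a α x, rr α (al a x) = al a (rr α x)     -- (a·x)·α = a·(x·α)

variable {R A X : Type*} [NormedRing R] [NormedAlgebra ℂ R]
  [NormedRing A] [NormedAlgebra ℂ A] [NormedAddCommGroup X] [NormedSpace ℂ X]

/-- A Banach `A`-`R`-module is commutative if the two `R`-actions coincide. -/
def ModuleActions.Commutative {act : AlgebraActions R A} (m : ModuleActions R A X act) : Prop :=
  ∀ α x, m.rl α x = m.rr α x

/-- A module derivation `D : A → X`. -/
def IsModuleDerivation {act : AlgebraActions R A} (m : ModuleActions R A X act)
    (D : A → X) : Prop :=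
  (∃ M > (0 : ℝ), ∀ a, ‖D a‖ ≤ M * ‖a‖) ∧
  (∀ a b, D (a + b) = D a + D b) ∧
  (∀ a b, D (a - b) = D a - D b) ∧
  (∀ a b, D (a * b) = m.ar b (D a) + m.al a (D b)) ∧
  (∀ α a, D (act.l α a) = m.rl α (D a)) ∧
  (∀ α a, D (act.r α a) = m.rr α (D a))

/-- An inner module derivation. -/
def IsInnerDerivation {act : AlgebraActions R A} (m : ModuleActions R A X act)
    (D : A → X) : Prop :=
  ∃ x, ∀ a, D a = m.al a x - m.ar a x

/-- `A` is module super-amenable as an `R`-module (with the given actions): every module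
derivation into every commutative Banach `A`-`R`-module is inner. -/
def ModuleSuperAmenable (R A : Type*) [NormedRing R] [NormedAlgebra ℂ R]
    [NormedRing A] [NormedAlgebra ℂ A] (act : AlgebraActions R A) : Prop :=
  ∀ (X : Type) [NormedAddCommGroup X] [NormedSpace ℂ X] [CompleteSpace X]
    (m : ModuleActions R A X act), m.Commutative →
    ∀ D : A → X, IsModuleDerivation m D → IsInnerDerivation m D

/-- A Banach algebra `A` is super-amenable (contractible) if every bounded derivation
from `A` into every Banach `A`-bimodule is inner. -/
def SuperAmenable (A : Type*) [NormedRing A] [NormedAlgebra ℂ A] : Prop :=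
  ∀ (X : Type) [NormedAddCommGroup X] [NormedSpace ℂ X] [CompleteSpace X]
    (al ar : A →L[ℂ] X →L[ℂ] X),
    (∀ a b x, al (a * b) x = al a (al b x)) →
    (∀ a b x, ar b (ar a x) = ar (a * b) x) →
    (∀ a b x, ar b (al a x) = al a (ar b x)) →
    ∀ D : A →L[ℂ] X, (∀ a b, D (a * b) = ar b (D a) + al a (D b)) →
    ∃ x, ∀ a, D a = al a x - ar a x

/-- A realization `T` of the (completed) projective tensor product `A ⊗̂ A` as a Banach
algebra, with the canonical bounded bilinear map `ι a b = a ⊗ b`. -/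
structure IsProjTensorSq (A T : Type*) [NormedRing A] [NormedAlgebra ℂ A]
    [NormedRing T] [NormedAlgebra ℂ T] (ι : A →L[ℂ] A →L[ℂ] T) : Prop where
  mul_ι : ∀ a b c d, ι a b * ι c d = ι (a * c) (b * d)
  norm_ι : ∀ a b, ‖ι a b‖ ≤ ‖a‖ * ‖b‖
  lift : ∀ (Y : Type) [NormedAddCommGroup Y] [NormedSpace ℂ Y] [CompleteSpace Y]
    (f : A →L[ℂ] A →L[ℂ] Y), ∃ g : T →L[ℂ] Y, (∀ a b, g (ι a b) = f a b) ∧ ‖g‖ ≤ ‖f‖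
  lift_unique : ∀ (Y : Type) [NormedAddCommGroup Y] [NormedSpace ℂ Y] [CompleteSpace Y]
    (g₁ g₂ : T →L[ℂ] Y), (∀ a b, g₁ (ι a b) = g₂ (ι a b)) → g₁ = g₂

/-- A set `t` in a Banach algebra is a closed (two-sided) ideal: a topologically closed
linear subspace stable under left and right multiplication. -/
def IsClosedIdealSet (A : Type*) [NormedRing A] [NormedAlgebra ℂ A] (t : Set A) : Prop :=
  IsClosed t ∧ (0 : A) ∈ t ∧ (∀ x ∈ t, ∀ y ∈ t, x + y ∈ t) ∧
    (∀ c : ℂ, ∀ x ∈ t, c • x ∈ t) ∧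
    (∀ a : A, ∀ x ∈ t, a * x ∈ t) ∧ (∀ a : A, ∀ x ∈ t, x * a ∈ t)

/-- The closed ideal generated by a set `s`: the smallest closed two-sided ideal
containing `s`. -/
def closedIdealGen (A : Type*) [NormedRing A] [NormedAlgebra ℂ A] (s : Set A) : Set A :=
  ⋂₀ {t : Set A | IsClosedIdealSet A t ∧ s ⊆ t}

/-- `π : A → Q` realizes `Q` as the quotient Banach space of `A` by the closed
subspace `N`: it is surjective, has kernel `N`, and carries the quotient norm. -/
structure IsQuotientOperator {A Q : Type*} [NormedAddCommGroup A] [NormedSpace ℂ A]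
    [NormedAddCommGroup Q] [NormedSpace ℂ Q] (π : A →L[ℂ] Q) (N : Set A) : Prop where
  surjective : Function.Surjective π
  ker : ∀ a, π a = 0 ↔ a ∈ N
  norm_eq : ∀ a : A, ‖π a‖ = sInf ((fun b => ‖a - b‖) '' N)

/-- `δ` realizes `A` as the semigroup Banach algebra `ℓ¹(S)` of the (discrete)
semigroup `S`, with `δ s` the point mass at `s`. -/
structure IsL1Of (S A : Type*) [Mul S] [NormedRing A] [NormedAlgebra ℂ A]
    (δ : S → A) : Prop where
  map_mul : ∀ s t : S, δ s * δ t = δ (s * t)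
  norm_combo : ∀ c : S →₀ ℂ, ‖c.sum fun s z => z • δ s‖ = ∑ s ∈ c.support, ‖c s‖
  dense_span : Dense ((Submodule.span ℂ (Set.range δ) : Submodule ℂ A) : Set A)

/-- `δ` realizes `B` as the semigroup Banach algebra `ℓ¹(E)` of a subsemigroup `E`
of `S`, with `δ e` the point mass at `e ∈ E`. -/
structure IsL1OfSubset (S : Type*) [Mul S] (E : Set S) (B : Type*) [NormedRing B]
    [NormedAlgebra ℂ B] (δ : S → B) : Prop where
  map_mul : ∀ e ∈ E, ∀ f ∈ E, δ e * δ f = δ (e * f)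
  norm_combo : ∀ c : S →₀ ℂ, (↑c.support : Set S) ⊆ E →
    ‖c.sum fun s z => z • δ s‖ = ∑ s ∈ c.support, ‖c s‖
  dense_span : Dense ((Submodule.span ℂ (δ '' E) : Submodule ℂ B) : Set B)

/-- If `𝔄` has an identity for `𝒜`, then super-amenability of `𝒜` implies its
module super-amenability as an `𝔄`-module. -/
theorem superAmenable_implies_moduleSuperAmenable
    (𝔄 𝒜 : Type*) [NormedRing 𝔄] [NormedAlgebra ℂ 𝔄] [CompleteSpace 𝔄]
    [NormedRing 𝒜] [NormedAlgebra ℂ 𝒜] [CompleteSpace 𝒜]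
    (act : AlgebraActions 𝔄 𝒜)
    (𝔢 : 𝔄) (h𝔢 : ∀ a : 𝒜, act.l 𝔢 a = a ∧ act.r 𝔢 a = a)
    (h : SuperAmenable 𝒜) :
    ModuleSuperAmenable 𝔄 𝒜 act := by
  intro X _ _ _ m _ D hD
  obtain ⟨⟨M, _, hM⟩, hadd, _, hmul, hl, _⟩ := hD
  have hsmul : ∀ (c : ℂ) (a : 𝒜), D (c • a) = c • D a := by
    intro c a
    have h1 : act.l (c • 𝔢) a = c • a := by
      rw [map_smul, ContinuousLinearMap.smul_apply, (h𝔢 a).1]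
    have h2 : m.rl 𝔢 (D a) = D a := by
      rw [← hl, (h𝔢 a).1]
    rw [← h1, hl, map_smul, ContinuousLinearMap.smul_apply, h2]
  let L : 𝒜 →ₗ[ℂ] X :=
    { toFun := D
      map_add' := hadd
      map_smul' := hsmul }
  exact h X m.al m.ar m.al_mul m.ar_mul m.al_ar (L.mkContinuous M hM) hmul
end

section
/- Let 𝒜 and ℬ be Banach algebras and Banach 𝔄-modules with compatible actions. If 𝒜 is 𝔄-module super-amenable and φ : 𝒜 → ℬ is a continuous Banach algebra homomorphism, also an 𝔄-module morphism, with dense range, then ℬ is 𝔄-module super-amenable. -/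
open scoped BigOperators

variable {R A X : Type*} [NormedRing R] [NormedAlgebra ℂ R]
  [NormedRing A] [NormedAlgebra ℂ A] [NormedAddCommGroup X] [NormedSpace ℂ X]

/-- Module super-amenability passes to dense ranges of continuous algebra
homomorphisms which are `𝔄`-module morphisms. -/
theorem moduleSuperAmenable_of_denseRange
    (𝔄 𝒜 ℬ : Type*) [NormedRing 𝔄] [NormedAlgebra ℂ 𝔄] [CompleteSpace 𝔄]
    [NormedRing 𝒜] [NormedAlgebra ℂ 𝒜] [CompleteSpace 𝒜]
    [NormedRing ℬ] [NormedAlgebra ℂ ℬ] [CompleteSpace ℬ]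
    (actA : AlgebraActions 𝔄 𝒜) (actB : AlgebraActions 𝔄 ℬ)
    (φ : 𝒜 →L[ℂ] ℬ) (hmul : ∀ a b : 𝒜, φ (a * b) = φ a * φ b)
    (hmodl : ∀ (α : 𝔄) (a : 𝒜), φ (actA.l α a) = actB.l α (φ a))
    (hmodr : ∀ (α : 𝔄) (a : 𝒜), φ (actA.r α a) = actB.r α (φ a))
    (hdense : DenseRange φ)
    (h : ModuleSuperAmenable 𝔄 𝒜 actA) :
    ModuleSuperAmenable 𝔄 ℬ actB := by
  intro X _ _ _ m hcomm D hD
  obtain ⟨⟨M, hM, hbd⟩, hadd, hsub, hDmul, hDl, hDr⟩ := hD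
  have hcont : Continuous D :=
    AddMonoidHomClass.continuous_of_bound (AddMonoidHom.mk' D hadd) M hbd
  let m' : ModuleActions 𝔄 𝒜 X actA :=
    { al := m.al.comp φ
      ar := m.ar.comp φ
      rl := m.rl
      rr := m.rr
      al_mul := fun a b x => by simp [hmul, m.al_mul]
      ar_mul := fun a b x => by simp [hmul, m.ar_mul]
      al_ar := fun a b x => by simp [m.al_ar]
      rl_mul := m.rl_mul
      rr_mul := m.rr_mul
      rl_rr := m.rl_rr
      compat1 := fun α a x => by simp [hmodl, m.compat1]
      compat2 := fun a α x => by simp [hmodr, m.compat2]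
      compat3 := fun α a x => by simp [m.compat3]
      compat4 := fun a α x => by simp [hmodr, m.compat4]
      compat5 := fun α a x => by simp [hmodl, m.compat5]
      compat6 := fun a α x => by simp [m.compat6] }
  have hder : IsModuleDerivation m' (fun a => D (φ a)) := by
    refine ⟨⟨M * (‖φ‖ + 1), by positivity, fun a => ?_⟩, fun a b => ?_, fun a b => ?_,
      fun a b => ?_, fun α a => ?_, fun α a => ?_⟩
    · calc ‖D (φ a)‖ ≤ M * ‖φ a‖ := hbd _
        _ ≤ M * ((‖φ‖ + 1) * ‖a‖) := by
          have h1 := φ.le_opNorm a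
          have h2 := norm_nonneg a
          gcongr
          linarith
        _ = M * (‖φ‖ + 1) * ‖a‖ := by ring
    · simp [hadd]
    · simp [hsub]
    · simp [m', hmul, hDmul]
    · simp [m', hmodl, hDl]
    · simp [m', hmodr, hDr]
  obtain ⟨x, hx⟩ := h X m' hcomm _ hder
  refine ⟨x, fun b => ?_⟩
  have key : D = fun b => m.al b x - m.ar b x :=
    hdense.equalizer hcont (by fun_prop) (funext hx)
  exact congrFun key b
end

section
/- Let 𝒜 be a Banach algebra which is a commutative Banach 𝒜-𝔄-module (with 𝒜 acting on itself by multiplication). Then 𝒜 is module super-amenable as an 𝔄-module if and only if 𝒜 has a module diagonal, i.e. an element M ∈ 𝒜 ⊗̂_𝔄 𝒜 = (𝒜 ⊗̂ 𝒜)/I such that ω̃(M) is an identity of 𝒜/J and a·M = M·a for all a ∈ 𝒜. -/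
open scoped BigOperators

variable {R A X : Type*} [NormedRing R] [NormedAlgebra ℂ R]
  [NormedRing A] [NormedAlgebra ℂ A] [NormedAddCommGroup X] [NormedSpace ℂ X]

section Helpers

/-- Bounded linear maps out of the projective tensor product agreeing on elementary tensors
agree. -/
theorem projTensor_ext {A Y : Type*} {T : Type} [NormedRing A] [NormedAlgebra ℂ A]
    [NormedRing T] [NormedAlgebra ℂ T] {ι : A →L[ℂ] A →L[ℂ] T}
    (hT : IsProjTensorSq A T ι) [NormedAddCommGroup Y] [NormedSpace ℂ Y]
    (g₁ g₂ : T →L[ℂ] Y) (h : ∀ a b, g₁ (ι a b) = g₂ (ι a b)) (t : T) : g₁ t = g₂ t := by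
  let K : Submodule ℂ T := (Submodule.span ℂ {x : T | ∃ a b, x = ι a b}).topologicalClosure
  have hKc : IsClosed (K : Set T) := Submodule.isClosed_topologicalClosure _
  have : IsClosed (K : Set T) := hKc
  let E := UniformSpace.Completion (T ⧸ K)
  let q : T →L[ℂ] (T ⧸ K) := LinearMap.mkContinuous K.mkQ 1 (fun x => by
    simpa using Submodule.Quotient.norm_mk_le K x)
  let p : T →L[ℂ] E := (UniformSpace.Completion.toComplL (𝕜 := ℂ) (E := T ⧸ K)).comp q
  have hp : p = 0 := by
    apply hT.lift_unique
    intro a b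
    have hq : q (ι a b) = 0 := by
      change K.mkQ (ι a b) = 0
      rw [Submodule.mkQ_apply, Submodule.Quotient.mk_eq_zero]
      exact Submodule.le_topologicalClosure _ (Submodule.subset_span ⟨a, b, rfl⟩)
    change ((q (ι a b) : T ⧸ K) : E) = 0
    rw [hq]
    exact UniformSpace.Completion.coe_zero
  have ht : t ∈ K := by
    have h1 : p t = 0 := by rw [hp]; rfl
    have h2 : q t = 0 := by
      have : ((q t : T ⧸ K) : E) = ((0 : T ⧸ K) : E) :=
        Eq.trans (b := (0 : E)) h1 (UniformSpace.Completion.coe_zero (α := T ⧸ K)).symm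
      exact UniformSpace.Completion.coe_injective _ this
    have h3 : K.mkQ t = 0 := h2
    rwa [Submodule.mkQ_apply, Submodule.Quotient.mk_eq_zero] at h3
  have hle : K ≤ LinearMap.ker ((g₁ - g₂ : T →L[ℂ] Y) : T →ₗ[ℂ] Y) := by
    apply Submodule.topologicalClosure_minimal
    · rw [Submodule.span_le]
      rintro x ⟨a, b, rfl⟩
      simp [h a b]
    · exact ContinuousLinearMap.isClosed_ker (g₁ - g₂)
  have := hle ht
  simpa [sub_eq_zero] using this

/-- Restricting a bounded action to an invariant subspace. -/
theorem restrict_action {B E : Type*} [NormedAddCommGroup B] [NormedSpace ℂ B]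
    [NormedAddCommGroup E] [NormedSpace ℂ E] (L : B →L[ℂ] E →L[ℂ] E) (K : Submodule ℂ E)
    (h : ∀ a, ∀ x ∈ K, L a x ∈ K) :
    ∃ L' : B →L[ℂ] K →L[ℂ] K, ∀ a x, ((L' a x : K) : E) = L a x := by
  refine ⟨LinearMap.mkContinuous₂ (LinearMap.mk₂ ℂ (fun a (x : K) => (⟨L a x, h a x x.2⟩ : K))
    ?_ ?_ ?_ ?_) ‖L‖ ?_, ?_⟩
  · intros; ext; simp
  · intros; ext; simp
  · intros; ext; simp
  · intros; ext; simp
  · intro a x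
    exact L.le_opNorm₂ a x
  · intro a x
    rfl

theorem act_l_eq {R A : Type*} [NormedRing R] [NormedAlgebra ℂ R]
    [NormedRing A] [NormedAlgebra ℂ A] (act : AlgebraActions R A) (α : R) (a : A) :
    act.l α a = act.l α 1 * a := by
  rw [← act.compat_left, one_mul]

theorem act_r_eq {R A : Type*} [NormedRing R] [NormedAlgebra ℂ R]
    [NormedRing A] [NormedAlgebra ℂ A] (act : AlgebraActions R A)
    (hcomm : ∀ α a, act.l α a = act.r α a) (α : R) (a : A) :
    act.r α a = a * act.l α 1 := by
  rw [hcomm, ← act.compat_right, mul_one]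

theorem act_central {R A : Type*} [NormedRing R] [NormedAlgebra ℂ R]
    [NormedRing A] [NormedAlgebra ℂ A] (act : AlgebraActions R A)
    (hcomm : ∀ α a, act.l α a = act.r α a) (α : R) (a : A) :
    act.l α 1 * a = a * act.l α 1 := by
  rw [← act_l_eq, hcomm, act_r_eq act hcomm]

/-- A bounded linear map killing the generators kills the whole closed ideal. -/
theorem kills_ideal {R A Y : Type*} {T : Type} [NormedRing R] [NormedAlgebra ℂ R]
    [NormedRing A] [NormedAlgebra ℂ A]
    [NormedRing T] [NormedAlgebra ℂ T] {ι : A →L[ℂ] A →L[ℂ] T}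
    (hT : IsProjTensorSq A T ι) [NormedAddCommGroup Y] [NormedSpace ℂ Y]
    (act : AlgebraActions R A) (hcomm : ∀ α a, act.l α a = act.r α a)
    (g : T →L[ℂ] Y) (hg : ∀ α a b, g (ι (act.l α a) b) = g (ι a (act.r α b)))
    (t : T) (ht : t ∈ closedIdealGen T
      {x : T | ∃ (α : R) (a b : A), x = ι (act.l α a) b - ι a (act.r α b)}) : g t = 0 := by
  have hK : IsClosedIdealSet T {t : T | ∀ s s', g (s * t * s') = 0} := by
    refine ⟨?_, ?_, ?_, ?_, ?_, ?_⟩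
    · simp only [Set.ofPred_forall]
      refine isClosed_iInter fun s => isClosed_iInter fun s' => ?_
      exact isClosed_eq (by fun_prop) continuous_const
    · intro s s'; simp
    · intro x hx y hy s s'
      rw [mul_add, add_mul, map_add, hx, hy, add_zero]
    · intro c x hx s s'
      rw [mul_smul_comm, smul_mul_assoc, map_smul, hx, smul_zero]
    · intro a x hx s s'
      have := hx (s * a) s'
      rwa [mul_assoc s a x] at this
    · intro a x hx s s'
      have := hx s (a * s')
      rwa [← mul_assoc, mul_assoc s x a] at this
  have hmem := ht _ ⟨hK, ?_⟩
  · simpa using hmem 1 1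
  rintro x ⟨α, a, b, rfl⟩ s s'
  set w := ι (act.l α a) b - ι a (act.r α b) with hw
  have key : ∀ c d e f, g (ι c d * w * ι e f) = 0 := by
    intro c d e f
    rw [hw, mul_sub, sub_mul, hT.mul_ι, hT.mul_ι, hT.mul_ι, hT.mul_ι, map_sub, sub_eq_zero]
    have := hg α (c * a * e) (d * b * f)
    rw [act_l_eq, act_r_eq act hcomm] at this
    rw [act_l_eq act α a, act_r_eq act hcomm α b]
    have e1 : c * (act.l α 1 * a) * e = act.l α 1 * (c * a * e) := by
      rw [← mul_assoc c, ← act_central act hcomm α c]; simp only [mul_assoc]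
    have e2 : d * (b * act.l α 1) * f = d * b * f * act.l α 1 := by
      have := act_central act hcomm α f
      simp only [mul_assoc, this]
    rw [e1, e2, this]
  have k2 : ∀ e f (s : T), g (s * w * ι e f) = 0 := by
    intro e f s
    exact projTensor_ext hT
      (g.comp (((ContinuousLinearMap.mul ℂ T).flip (ι e f)).comp
        ((ContinuousLinearMap.mul ℂ T).flip w))) 0 (fun c d => by simpa using key c d e f) s
  exact projTensor_ext hT
      (g.comp (ContinuousLinearMap.mul ℂ T (s * w))) 0 (fun e f => by simpa using k2 e f s) s'

/-- A module derivation on a unital algebra is automatically complex linear. -/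
theorem derivation_linear {R A X : Type*} [NormedRing R] [NormedAlgebra ℂ R]
    [NormedRing A] [NormedAlgebra ℂ A] [NormedAddCommGroup X] [NormedSpace ℂ X]
    {act : AlgebraActions R A} (m : ModuleActions R A X act) (D : A → X)
    (hD : IsModuleDerivation m D) : ∃ D' : A →L[ℂ] X, ∀ a, D' a = D a := by
  obtain ⟨⟨C, hC, hb⟩, hadd, hsub, hmul, -, -⟩ := hD
  let Dh : A →+ X := AddMonoidHom.mk' D hadd
  have hcont : Continuous Dh := AddMonoidHomClass.continuous_of_bound Dh C hb
  have hreal : ∀ (r : ℝ) a, D (r • a) = r • D a := fun r a => map_real_smul Dh hcont r a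
  have hneg : ∀ a, D (-a) = - D a := fun a => map_neg Dh a
  have hI1 : ∀ x, m.al (Complex.I • (1 : A)) x = Complex.I • m.al 1 x := by intro x; simp
  have hI2 : ∀ x, m.ar (Complex.I • (1 : A)) x = Complex.I • m.ar 1 x := by intro x; simp
  have ee : ∀ x, m.al 1 (m.al 1 x) = m.al 1 x := by intro x; rw [← m.al_mul, one_mul]
  have d1 : D 1 = m.ar 1 (D 1) + m.al 1 (D 1) := by simpa using hmul 1 1
  have d2 : D (Complex.I • (1:A)) = m.ar 1 (D (Complex.I • (1:A))) + Complex.I • m.al 1 (D 1) := by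
    have := hmul (Complex.I • 1) 1
    rwa [mul_one, hI1] at this
  have d3 : D (Complex.I • (1:A)) = Complex.I • m.ar 1 (D 1) + m.al 1 (D (Complex.I • (1:A))) := by
    have := hmul 1 (Complex.I • 1)
    rwa [one_mul, hI2] at this
  have d4 : - D 1 = Complex.I • m.ar 1 (D (Complex.I • (1:A)))
      + Complex.I • m.al 1 (D (Complex.I • (1:A))) := by
    have := hmul (Complex.I • 1) (Complex.I • 1)
    rw [hI1, hI2, smul_mul_smul_comm, one_mul, Complex.I_mul_I, neg_smul, one_smul, hneg] at this
    exact this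
  have dI : D (Complex.I • (1:A)) = Complex.I • D 1 := by
    -- adding d2 and d3: 2 D(i) = i D(1) + (D(i)·1 + 1·D(i)) = i D(1) + i D(1)
    have h5 : m.ar 1 (D (Complex.I • (1:A))) + m.al 1 (D (Complex.I • (1:A)))
        = Complex.I • D 1 := by
      have : Complex.I • (- D 1) = Complex.I • (Complex.I • (m.ar 1 (D (Complex.I • (1:A)))
        + m.al 1 (D (Complex.I • (1:A))))) := by rw [d4, ← smul_add]
      rw [smul_smul, Complex.I_mul_I, neg_smul, one_smul, smul_neg] at this
      exact (neg_injective this).symm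
    have h6 : (2:ℂ) • D (Complex.I • (1:A)) = (2:ℂ) • (Complex.I • D 1) := by
      calc (2:ℂ) • D (Complex.I • (1:A)) = D (Complex.I • (1:A)) + D (Complex.I • (1:A)) :=
            two_smul _ _
        _ = (m.ar 1 (D (Complex.I • (1:A))) + Complex.I • m.al 1 (D 1)) +
            (Complex.I • m.ar 1 (D 1) + m.al 1 (D (Complex.I • (1:A)))) := by
              rw [← d2, ← d3]
        _ = (m.ar 1 (D (Complex.I • (1:A))) + m.al 1 (D (Complex.I • (1:A))))
            + Complex.I • (m.ar 1 (D 1) + m.al 1 (D 1)) := by rw [smul_add]; abel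
        _ = _ := by rw [h5, ← d1, two_smul]
    exact smul_right_injective X (two_ne_zero (α := ℂ)) h6
  have hDI : ∀ a, D (Complex.I • a) = Complex.I • D a := by
    intro a
    have h1 := hmul (Complex.I • 1) a
    have h2 := hmul 1 a
    rw [one_mul] at h2
    rw [smul_mul_assoc, one_mul, hI1, dI, map_smul, ← smul_add, ← h2] at h1
    exact h1
  have hsmul : ∀ (c : ℂ) a, D (c • a) = c • D a := by
    intro c a
    have hc : c • a = c.re • a + c.im • (Complex.I • a) := by
      conv_lhs => rw [← Complex.re_add_im c, add_smul, mul_smul]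
      simp
    have hc' : c • D a = c.re • D a + c.im • (Complex.I • D a) := by
      conv_lhs => rw [← Complex.re_add_im c, add_smul, mul_smul]
      simp
    rw [hc, hadd, hreal, hreal, hDI, hc']
  exact ⟨LinearMap.mkContinuous ⟨⟨D, hadd⟩, hsmul⟩ C hb, fun a => rfl⟩

end Helpers

/-- a commutative Banach `𝒜`-`𝔄`-module `𝒜` is module super-amenable iff it has
a module diagonal, i.e. an element `M` of `𝒜 ⊗̂_𝔄 𝒜 = (𝒜 ⊗̂ 𝒜)/I` such that `ω̃(M)` is an
identity of `𝒜/J` and `a·M = M·a` for all `a ∈ 𝒜`. -/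
theorem moduleSuperAmenable_iff_moduleDiagonal
    (𝔄 𝒜 : Type*) [NormedRing 𝔄] [NormedAlgebra ℂ 𝔄] [CompleteSpace 𝔄]
    [NormedRing 𝒜] [NormedAlgebra ℂ 𝒜] [CompleteSpace 𝒜]
    (act : AlgebraActions 𝔄 𝒜) (hcomm : ∀ α a, act.l α a = act.r α a)
    -- `T` is a realization of the projective tensor product `𝒜 ⊗̂ 𝒜`
    (T : Type) [NormedRing T] [NormedAlgebra ℂ T] [CompleteSpace T]
    (ι : 𝒜 →L[ℂ] 𝒜 →L[ℂ] T) (hT : IsProjTensorSq 𝒜 T ι)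
    -- the multiplication operator `ω`
    (ω : T →L[ℂ] 𝒜) (hω : ∀ a b : 𝒜, ω (ι a b) = a * b)
    -- the ideals `I` and `J`
    (Iset : Set T)
    (hI : Iset = closedIdealGen T
      {x : T | ∃ (α : 𝔄) (a b : 𝒜), x = ι (act.l α a) b - ι a (act.r α b)})
    (Jset : Set 𝒜) (hJ : Jset = closedIdealGen 𝒜 (ω '' Iset))
    -- `Q` is the quotient Banach algebra `𝒜/J`
    (Q : Type) [NormedRing Q] [NormedAlgebra ℂ Q] [CompleteSpace Q]
    (π : 𝒜 →L[ℂ] Q) (hπmul : ∀ a b : 𝒜, π (a * b) = π a * π b)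
    (hπ : IsQuotientOperator π Jset)
    -- `TQ` is the module projective tensor product `𝒜 ⊗̂_𝔄 𝒜 = (𝒜 ⊗̂ 𝒜)/I`
    (TQ : Type) [NormedAddCommGroup TQ] [NormedSpace ℂ TQ] [CompleteSpace TQ]
    (πT : T →L[ℂ] TQ) (hπT : IsQuotientOperator πT Iset)
    -- the induced map `ω̃ : 𝒜 ⊗̂_𝔄 𝒜 → 𝒜/J`
    (ω' : TQ →L[ℂ] Q) (hω' : ∀ t : T, ω' (πT t) = π (ω t))
    -- the canonical `𝒜`-actions on `𝒜 ⊗̂ 𝒜`: `a·(b⊗c) = ab⊗c`, `(b⊗c)·a = b⊗ca`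
    (Lact Ract : 𝒜 →L[ℂ] T →L[ℂ] T)
    (hL : ∀ a b c : 𝒜, Lact a (ι b c) = ι (a * b) c)
    (hR : ∀ a b c : 𝒜, Ract a (ι b c) = ι b (c * a))
    -- the induced `𝒜`-actions on `𝒜 ⊗̂_𝔄 𝒜`
    (LQ RQ : 𝒜 →L[ℂ] TQ →L[ℂ] TQ)
    (hLQ : ∀ (a : 𝒜) (t : T), LQ a (πT t) = πT (Lact a t))
    (hRQ : ∀ (a : 𝒜) (t : T), RQ a (πT t) = πT (Ract a t)) :
    ModuleSuperAmenable 𝔄 𝒜 act ↔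
      ∃ M : TQ, (∀ q : Q, q * ω' M = q ∧ ω' M * q = q) ∧ ∀ a : 𝒜, LQ a M = RQ a M := by
  have hgen : ∀ t ∈ Iset, πT t = 0 := fun t ht => (hπT.ker t).2 ht
  constructor
  · intro hSA
    -- generators lie in `I`
    have hrel : ∀ α a b, πT (ι (act.l α a) b) = πT (ι a (act.r α b)) := by
      intro α a b
      rw [← sub_eq_zero, ← map_sub]
      apply hgen
      rw [hI]
      rintro t ⟨-, ht⟩
      exact ht ⟨α, a, b, rfl⟩
    have ext2 : ∀ (g₁ g₂ : TQ →L[ℂ] TQ), (∀ a b, g₁ (πT (ι a b)) = g₂ (πT (ι a b))) →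
        ∀ N, g₁ N = g₂ N := by
      intro g₁ g₂ h N
      obtain ⟨t, rfl⟩ := hπT.surjective N
      exact projTensor_ext hT (g₁.comp πT) (g₂.comp πT) h t
    have hLL : ∀ a b N, LQ (a * b) N = LQ a (LQ b N) := by
      intro a b N
      refine ext2 (LQ (a * b)) ((LQ a).comp (LQ b)) (fun c d => ?_) N
      simp [hLQ, hL, mul_assoc]
    have hRR : ∀ a b N, RQ b (RQ a N) = RQ (a * b) N := by
      intro a b N
      refine ext2 ((RQ b).comp (RQ a)) (RQ (a * b)) (fun c d => ?_) N
      simp [hRQ, hR, mul_assoc]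
    have hLR : ∀ a b N, RQ b (LQ a N) = LQ a (RQ b N) := by
      intro a b N
      refine ext2 ((RQ b).comp (LQ a)) ((LQ a).comp (RQ b)) (fun c d => ?_) N
      simp [hRQ, hR, hLQ, hL]
    have hz : ∀ α N, LQ (act.l α 1) N = RQ (act.l α 1) N := by
      intro α N
      refine ext2 (LQ (act.l α 1)) (RQ (act.l α 1)) (fun c d => ?_) N
      rw [hLQ, hRQ, hL, hR, ← act_l_eq, hrel, act_r_eq act hcomm]
    have hωL : ∀ a N, ω' (LQ a N) = π a * ω' N := by
      intro a N
      obtain ⟨t, rfl⟩ := hπT.surjective N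
      refine projTensor_ext hT ((ω'.comp (LQ a)).comp πT)
        ((ContinuousLinearMap.mul ℂ Q (π a)).comp (ω'.comp πT)) (fun c d => ?_) t
      simp [hLQ, hL, hω', hω, hπmul, mul_assoc]
    have hωR : ∀ a N, ω' (RQ a N) = ω' N * π a := by
      intro a N
      obtain ⟨t, rfl⟩ := hπT.surjective N
      refine projTensor_ext hT ((ω'.comp (RQ a)).comp πT)
        (((ContinuousLinearMap.mul ℂ Q).flip (π a)).comp (ω'.comp πT)) (fun c d => ?_) t
      simp [hRQ, hR, hω', hω, hπmul, mul_assoc]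
    let K : Submodule ℂ TQ := LinearMap.ker (ω' : TQ →ₗ[ℂ] Q)
    have hK : ∀ x, x ∈ K ↔ ω' x = 0 := fun x => LinearMap.mem_ker
    have hKcl : IsClosed (K : Set TQ) := ContinuousLinearMap.isClosed_ker ω'
    have : CompleteSpace K := hKcl.completeSpace_coe
    obtain ⟨L', hL'⟩ := restrict_action LQ K (fun a x hx => by
      rw [hK] at hx ⊢; rw [hωL, hx, mul_zero])
    obtain ⟨R', hR'⟩ := restrict_action RQ K (fun a x hx => by
      rw [hK] at hx ⊢; rw [hωR, hx, zero_mul])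
    let Z : 𝔄 →L[ℂ] 𝒜 := act.l.flip 1
    have hZ : ∀ α, Z α = act.l α 1 := fun α => rfl
    have hZc : ∀ α a, Z α * a = a * Z α := fun α a => act_central act hcomm α a
    have hZm : ∀ α β, Z (α * β) = Z α * Z β := by
      intro α β
      rw [hZ, act.l_mul_l, act_l_eq act α, ← hZ, ← hZ]
    have hl : ∀ α a, act.l α a = Z α * a := fun α a => act_l_eq act α a
    have hr : ∀ α a, act.r α a = a * Z α := fun α a => act_r_eq act hcomm α a
    have hzz : ∀ α N, LQ (Z α) N = RQ (Z α) N := hz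
    let m : ModuleActions 𝔄 𝒜 K act :=
      { al := L'
        ar := R'
        rl := L'.comp Z
        rr := L'.comp Z
        al_mul := fun a b x => Subtype.ext (by simp [hL', hLL])
        ar_mul := fun a b x => Subtype.ext (by simp [hR', hRR])
        al_ar := fun a b x => Subtype.ext (by simp [hR', hL', hLR])
        rl_mul := fun α β x => Subtype.ext (by simp [hL', hZm, hLL])
        rr_mul := fun α β x => Subtype.ext (by
          simp only [ContinuousLinearMap.comp_apply, hL', hZm]
          rw [← hLL, hZc])
        rl_rr := fun α β x => Subtype.ext (by
          simp only [ContinuousLinearMap.comp_apply, hL']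
          rw [← hLL, hZc, hLL])
        compat1 := fun α a x => Subtype.ext (by
          simp only [ContinuousLinearMap.comp_apply, hL', hl]
          rw [← hLL])
        compat2 := fun a α x => Subtype.ext (by
          simp only [ContinuousLinearMap.comp_apply, hL', hr]
          rw [← hLL])
        compat3 := fun α a x => Subtype.ext (by
          simp only [ContinuousLinearMap.comp_apply, hL', hR']
          rw [hLR])
        compat4 := fun a α x => Subtype.ext (by
          simp only [ContinuousLinearMap.comp_apply, hL', hR', hr]
          rw [hzz, hRR])
        compat5 := fun α a x => Subtype.ext (by
          simp only [ContinuousLinearMap.comp_apply, hL', hR', hl]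
          rw [hzz, hRR])
        compat6 := fun a α x => Subtype.ext (by
          simp only [ContinuousLinearMap.comp_apply, hL']
          rw [← hLL, ← hLL, hZc]) }
    let D0 : 𝒜 →L[ℂ] TQ := πT.comp (ι.flip 1 - ι 1)
    have hD0 : ∀ a, D0 a = πT (ι a 1) - πT (ι 1 a) := by intro a; simp [D0]
    have hD0K : ∀ a, D0 a ∈ K := by
      intro a
      rw [hK, hD0, map_sub, hω', hω', hω, hω, mul_one, one_mul, sub_self]
    let D : 𝒜 → K := fun a => ⟨D0 a, hD0K a⟩
    have hDl : ∀ α a, D0 (Z α * a) = LQ (Z α) (D0 a) := by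
      intro α a
      rw [hD0, hD0, map_sub, hLQ, hLQ, hL, hL, mul_one]
      congr 1
      rw [hZc, hZ, hrel, hr]; rfl
    have hD : IsModuleDerivation m D := by
      refine ⟨⟨‖D0‖ + 1, by positivity, fun a => ?_⟩, ?_, ?_, ?_, ?_, ?_⟩
      · calc ‖D a‖ = ‖D0 a‖ := rfl
          _ ≤ ‖D0‖ * ‖a‖ := D0.le_opNorm a
          _ ≤ _ := by gcongr; linarith
      · intro a b; exact Subtype.ext (map_add D0 a b)
      · intro a b; exact Subtype.ext (map_sub D0 a b)
      · intro a b
        apply Subtype.ext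
        change D0 (a * b) = ((R' b (D a) : K) : TQ) + ((L' a (D b) : K) : TQ)
        rw [hR', hL']
        change D0 (a * b) = RQ b (D0 a) + LQ a (D0 b)
        simp only [hD0, map_sub, hLQ, hRQ, hL, hR, one_mul, mul_one]
        abel
      · intro α a
        apply Subtype.ext
        change D0 (act.l α a) = ((L' (Z α) (D a) : K) : TQ)
        rw [hL', hl]
        exact hDl α a
      · intro α a
        apply Subtype.ext
        change D0 (act.r α a) = ((L' (Z α) (D a) : K) : TQ)
        rw [hL', hr, ← hZc]
        exact hDl α a
    obtain ⟨N, hN⟩ := hSA K m (fun α x => rfl) D hD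
    have hN' : ∀ a, D0 a = LQ a N - RQ a N := by
      intro a
      rw [← hL', ← hR']
      exact congrArg Subtype.val (hN a)
    refine ⟨πT (ι 1 1) - N, ?_, ?_⟩
    · have h1 : ω' (πT (ι 1 1) - N) = π 1 := by
        rw [map_sub, hω', hω, (hK _).1 N.2, sub_zero, one_mul]
      intro q
      obtain ⟨a, rfl⟩ := hπ.surjective q
      rw [h1, ← hπmul, ← hπmul, mul_one, one_mul]
      exact ⟨rfl, rfl⟩
    · intro a
      have h1 := hN' a
      rw [hD0] at h1
      rw [map_sub, map_sub, hLQ, hRQ, hL, hR, mul_one, one_mul]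
      rw [sub_eq_sub_iff_add_eq_add] at h1 ⊢
      rw [h1, add_comm]
  · rintro ⟨M, hM1, hM2⟩ X _ _ _ m hm D hD
    obtain ⟨D', hD'⟩ := derivation_linear m D hD
    obtain ⟨t, rfl⟩ := hπT.surjective M
    obtain ⟨-, -, -, hmul, hDl, hDr⟩ := hD
    simp only [← hD'] at hmul hDl hDr
    -- `ω t = 1`
    have hω0 : ∀ s ∈ Iset, ω s = 0 := by
      intro s hs
      rw [hI] at hs
      refine kills_ideal hT act hcomm ω (fun α a b => ?_) s hs
      rw [hω, hω, act_l_eq, act_r_eq act hcomm, mul_assoc, act_central act hcomm, mul_assoc]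
    have hJ0 : ∀ a ∈ Jset, a = 0 := by
      intro a ha
      rw [hJ] at ha
      refine ha {0} ⟨⟨isClosed_singleton, by simp, by simp, by simp, by simp, by simp⟩, ?_⟩
      rintro _ ⟨s, hs, rfl⟩
      exact hω0 s hs
    have hωt : ω t = 1 := by
      rw [← sub_eq_zero]
      apply hJ0
      rw [← hπ.ker, map_sub, ← hω', sub_eq_zero]
      obtain ⟨u, hu⟩ := hπ.surjective 1
      have h1 := (hM1 1).1
      have h2 : π u * π 1 = π u := by rw [← hπmul, mul_one]
      rw [hu, one_mul] at h2
      rw [one_mul] at h1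
      rw [h1, h2]
    -- the map `a ⊗ b ↦ a · D b`
    obtain ⟨g, hg, -⟩ := hT.lift X ((ContinuousLinearMap.compL ℂ 𝒜 X X).flip D' ∘L m.al)
    have hg' : ∀ a b, g (ι a b) = m.al a (D' b) := by
      intro a b; rw [hg]; rfl
    have hgI : ∀ s ∈ Iset, g s = 0 := by
      intro s hs
      rw [hI] at hs
      refine kills_ideal hT act hcomm g (fun α a b => ?_) s hs
      rw [hg', hg', hDr, ← hm, m.compat2, hcomm]
    have hgL : ∀ a s, g (Lact a s) = m.al a (g s) := by
      intro a s
      refine projTensor_ext hT (g.comp (Lact a)) ((m.al a).comp g) (fun b c => ?_) s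
      simp [hL, hg', m.al_mul]
    have hgR : ∀ a s, g (Ract a s) = m.ar a (g s) + m.al (ω s) (D' a) := by
      intro a s
      refine projTensor_ext hT (g.comp (Ract a))
        ((m.ar a).comp g + (m.al.flip (D' a)).comp ω) (fun b c => ?_) s
      simp [hR, hg', hω, hmul, m.al_mul, m.al_ar]
    have key : ∀ a, m.al a (g t) = m.ar a (g t) + m.al 1 (D' a) := by
      intro a
      have h := hM2 a
      rw [hLQ, hRQ, ← sub_eq_zero, ← map_sub, hπT.ker] at h
      have := hgI _ h
      rwa [map_sub, sub_eq_zero, hgL, hgR, hωt] at this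
    have d1 : D' 1 = m.ar 1 (D' 1) + m.al 1 (D' 1) := by simpa using hmul 1 1
    have ee : m.al 1 (m.al 1 (D' 1)) = m.al 1 (D' 1) := by rw [← m.al_mul, one_mul]
    have d2 : m.ar 1 (m.al 1 (D' 1)) = 0 := by
      have h := congrArg (m.al 1) d1
      rw [map_add, ee] at h
      rw [m.al_ar]
      simpa using h
    have d3 : ∀ a, m.ar a (m.al 1 (D' 1)) = 0 := by
      intro a
      rw [← one_mul a, ← m.ar_mul, d2, map_zero]
    refine ⟨g t - D' 1 + m.al 1 (D' 1), fun a => ?_⟩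
    have h1 : m.al a (m.al 1 (D' 1)) = m.al a (D' 1) := by rw [← m.al_mul, mul_one]
    have h2 : D' a = m.ar a (D' 1) + m.al 1 (D' a) := by simpa using hmul 1 a
    rw [← hD', map_add, map_add, map_sub, map_sub, h1, d3, key, h2]
    have h3 : m.al 1 (m.ar a (D' 1) + m.al 1 (D' a)) = m.al 1 (D' a) := by rw [← h2]
    rw [h3]
    abel
end

section
/- Let 𝒜 be a Banach 𝔄-module with trivial left action (α·a = f(α)a for a fixed continuous linear functional f on 𝔄). If 𝒜 is module super-amenable as an 𝔄-module and the quotient 𝒜/J is a commutative 𝔄-module, then the Banach algebra 𝒜/J is super-amenable. -/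
open scoped BigOperators

variable {R A X : Type*} [NormedRing R] [NormedAlgebra ℂ R]
  [NormedRing A] [NormedAlgebra ℂ A] [NormedAddCommGroup X] [NormedSpace ℂ X]

/-- if `𝔄` acts trivially on `𝒜` from the left, `𝒜` is module super-amenable
and `𝒜/J` is a commutative `𝔄`-module, then the Banach algebra `𝒜/J` is super-amenable. -/
theorem superAmenable_quotient_of_moduleSuperAmenable
    (𝔄 𝒜 : Type*) [NormedRing 𝔄] [NormedAlgebra ℂ 𝔄] [CompleteSpace 𝔄]
    [NormedRing 𝒜] [NormedAlgebra ℂ 𝒜] [CompleteSpace 𝒜]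
    (act : AlgebraActions 𝔄 𝒜)
    -- the left action is trivial, given by a continuous linear functional `f`
    (f : 𝔄 →L[ℂ] ℂ) (hf : ∀ (α : 𝔄) (a : 𝒜), act.l α a = f α • a)
    -- `T` is a realization of the projective tensor product `𝒜 ⊗̂ 𝒜`
    (T : Type) [NormedRing T] [NormedAlgebra ℂ T] [CompleteSpace T]
    (ι : 𝒜 →L[ℂ] 𝒜 →L[ℂ] T) (hT : IsProjTensorSq 𝒜 T ι)
    (ω : T →L[ℂ] 𝒜) (hω : ∀ a b : 𝒜, ω (ι a b) = a * b)
    (Iset : Set T)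
    (hI : Iset = closedIdealGen T
      {x : T | ∃ (α : 𝔄) (a b : 𝒜), x = ι (act.l α a) b - ι a (act.r α b)})
    (Jset : Set 𝒜) (hJ : Jset = closedIdealGen 𝒜 (ω '' Iset))
    -- `Q` is the quotient Banach algebra `𝒜/J`
    (Q : Type) [NormedRing Q] [NormedAlgebra ℂ Q] [CompleteSpace Q]
    (π : 𝒜 →L[ℂ] Q) (hπmul : ∀ a b : 𝒜, π (a * b) = π a * π b)
    (hπ : IsQuotientOperator π Jset)
    -- the induced `𝔄`-actions on `𝒜/J`
    (actQ : AlgebraActions 𝔄 Q)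
    (hQl : ∀ (α : 𝔄) (a : 𝒜), actQ.l α (π a) = π (act.l α a))
    (hQr : ∀ (α : 𝔄) (a : 𝒜), actQ.r α (π a) = π (act.r α a))
    -- `𝒜/J` is a commutative `𝔄`-module
    (hQcomm : ∀ (α : 𝔄) (q : Q), actQ.l α q = actQ.r α q)
    (h : ModuleSuperAmenable 𝔄 𝒜 act) :
    SuperAmenable Q := by
  have hr : ∀ (α : 𝔄) (a : 𝒜), π (act.r α a) = f α • π a := by
    intro α a
    rw [← hQr, ← hQcomm, hQl, hf, map_smul]
  intro X _ _ _ al ar hal har halar D hD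
  rcases subsingleton_or_nontrivial 𝒜 with hs | hn
  · refine ⟨0, fun q => ?_⟩
    obtain ⟨a, rfl⟩ := hπ.surjective q
    rw [Subsingleton.elim a 0]
    simp
  have hfm : ∀ α β : 𝔄, f (α * β) = f α * f β := by
    intro α β
    have h1 := act.l_mul_l α β 1
    rw [hf, hf, hf, smul_smul] at h1
    exact smul_left_injective ℂ (one_ne_zero : (1 : 𝒜) ≠ 0) h1
  let S : 𝔄 →L[ℂ] X →L[ℂ] X := f.smulRight (ContinuousLinearMap.id ℂ X)
  have hS : ∀ α x, S α x = f α • x := fun α x => by simp [S]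
  let m : ModuleActions 𝔄 𝒜 X act :=
    { al := al.comp π
      ar := ar.comp π
      rl := S
      rr := S
      al_mul := fun a b x => by simp [hπmul, hal]
      ar_mul := fun a b x => by simp [hπmul, har]
      al_ar := fun a b x => by simp [halar]
      rl_mul := fun α β x => by simp [hS, hfm, smul_smul]
      rr_mul := fun α β x => by simp [hS, hfm, smul_smul, mul_comm]
      rl_rr := fun α β x => by simp [hS, smul_smul, mul_comm]
      compat1 := fun α a x => by simp [hS, hf]
      compat2 := fun a α x => by simp [hS, hr]
      compat3 := fun α a x => by simp [hS]
      compat4 := fun a α x => by simp [hS, hr]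
      compat5 := fun α a x => by simp [hS, hf]
      compat6 := fun a α x => by simp [hS] }
  have hder : IsModuleDerivation m (D.comp π) := by
    refine ⟨(D.comp π).bound, fun a b => map_add _ a b, fun a b => map_sub _ a b, ?_, ?_, ?_⟩
    · intro a b
      simp [m, hπmul, hD]
    · intro α a
      simp [m, hS, hf]
    · intro α a
      simp [m, hS, hr]
  obtain ⟨x, hx⟩ := h X m (fun α x => rfl) _ hder
  refine ⟨x, fun q => ?_⟩
  obtain ⟨a, rfl⟩ := hπ.surjective q
  exact hx a
end

section
/- Let S = (ℕ, ∨) be the commutative inverse semigroup of positive integers with the maximum operation m ∨ n = max(m, n), so that every element of S is an idempotent (E = ℕ). Then the quotient S/≈ is the trivial group with one element; that is, δ_m − δ_n ∈ J for all m, n ∈ ℕ, and consequently ℓ¹(ℕ, ∨) is module super-amenable as an ℓ¹(ℕ, ∨)-module (with trivial left action and multiplication as right action). -/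
open scoped BigOperators

variable {R A X : Type*} [NormedRing R] [NormedAlgebra ℂ R]
  [NormedRing A] [NormedAlgebra ℂ A] [NormedAddCommGroup X] [NormedSpace ℂ X]

/-- for `S = (ℕ⁺, ∨)` (all elements idempotent, so `E = ℕ⁺`), the quotient
`S/≈` is trivial: `δ_m - δ_n ∈ J` for all `m, n`, and consequently `ℓ¹(ℕ⁺, ∨)` is module
super-amenable as an `ℓ¹(ℕ⁺, ∨)`-module (trivial left action, multiplication on the right). -/
theorem l1_nat_max_moduleSuperAmenable
    (A : Type*) [NormedRing A] [NormedAlgebra ℂ A] [CompleteSpace A]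
    -- `A` is `ℓ¹(ℕ⁺, ∨)`
    (δ : ℕ+ → A)
    (hmul : ∀ m n : ℕ+, δ m * δ n = δ (max m n))
    (hnorm : ∀ c : ℕ+ →₀ ℂ, ‖c.sum fun s z => z • δ s‖ = ∑ s ∈ c.support, ‖c s‖)
    (hdense : Dense ((Submodule.span ℂ (Set.range δ) : Submodule ℂ A) : Set A))
    -- `J` is the closed linear span of `{δ_{s∨e∨t} - δ_{s∨t}}`
    (Jset : Set A)
    (hJ : Jset = closure ((Submodule.span ℂ
      {x : A | ∃ s t e : ℕ+, x = δ (max (max s e) t) - δ (max s t)} : Submodule ℂ A) : Set A)) :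
    (∀ m n : ℕ+, δ m - δ n ∈ Jset) ∧
    ∀ act : AlgebraActions A A,
      (∀ e s : ℕ+, act.l (δ e) (δ s) = δ s) →
      (∀ α a : A, act.r α a = a * α) →
      ModuleSuperAmenable A A act := by
  constructor
  · intro m n
    rw [hJ]
    apply subset_closure
    have h1 : ∀ m n : ℕ+, δ (max m n) - δ n ∈ Submodule.span ℂ
        {x : A | ∃ s t e : ℕ+, x = δ (max (max s e) t) - δ (max s t)} := by
      intro m n
      apply Submodule.subset_span
      refine ⟨n, n, m, ?_⟩
      rw [max_self, max_comm n m, max_assoc, max_self]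
    have h2 := Submodule.sub_mem _ (h1 m n) (h1 n m)
    rw [max_comm n m] at h2
    have h3 : δ m - δ n = (δ (max m n) - δ n) - (δ (max m n) - δ m) := by abel
    rw [h3]
    exact h2
  · intro act hl hr X _ _ _ m hcomm D hD
    obtain ⟨_, _, _, hder, hDl, hDr⟩ := hD
    have hone : ∀ a : A, δ 1 * a = a := by
      have : ContinuousLinearMap.mul ℂ A (δ 1) = ContinuousLinearMap.id ℂ A := by
        apply ContinuousLinearMap.ext_on hdense
        rintro _ ⟨n, rfl⟩
        simp [hmul]
      intro a
      simpa using congrArg (fun f => f a) this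
    have hDa : ∀ a, D a = m.rr a (D (δ 1)) := by
      intro a
      rw [← hDr, hr, hone]
    have hd : ∀ n, D (δ n) = D (δ 1) := by
      intro n
      rw [hDa, ← hcomm, ← hDl, hl]
    have hsum : ∀ i j, m.ar (δ j) (D (δ 1)) + m.al (δ i) (D (δ 1)) = D (δ 1) := by
      intro i j
      have h := hder (δ i) (δ j)
      rw [hmul, hd, hd i, hd j] at h
      exact h.symm
    set d := D (δ 1) with hdd
    set p := m.al (δ 1) d with hp
    set q := m.ar (δ 1) d with hq
    have hqp : q + p = d := hsum 1 1
    have hap : ∀ i, m.al (δ i) d = p := fun i =>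
      add_left_cancel ((hsum i 1).trans (hsum 1 1).symm)
    have haq : ∀ i, m.ar (δ i) d = q := fun i =>
      add_right_cancel ((hsum 1 i).trans (hsum 1 1).symm)
    have h1 : ∀ i, m.al (δ i) p = p := by
      intro i
      rw [← hap i, ← m.al_mul, hmul, max_self]
    have h2 : ∀ i, m.ar (δ i) q = q := by
      intro i
      rw [← haq i, m.ar_mul, hmul, max_self]
    have h3 : ∀ i, m.al (δ i) q = 0 := by
      intro i
      have : q = d - p := by rw [← hqp]; abel
      rw [this, map_sub, hap, h1, sub_self]
    have h4 : ∀ i, m.ar (δ i) p = 0 := by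
      intro i
      have : p = d - q := by rw [← hqp]; abel
      rw [this, map_sub, haq, h2, sub_self]
    refine ⟨p - q, ?_⟩
    have key : m.rr.flip d = m.al.flip (p - q) - m.ar.flip (p - q) := by
      apply ContinuousLinearMap.ext_on hdense
      rintro _ ⟨n, rfl⟩
      simp only [ContinuousLinearMap.flip_apply, sub_apply, map_sub]
      rw [← hDa, hd, h1, h2, h3, h4, ← hqp]
      abel
    intro a
    rw [hDa]
    simpa using congrArg (fun f => f a) key
end

section
/- The Banach algebra ℓ¹(ℕ, ∨) (absolutely summable functions on the positive integers with convolution induced by the maximum operation) has no diagonal: there is no element M of ℓ¹(ℕ,∨) ⊗̂ ℓ¹(ℕ,∨) satisfying a·ω(M) = a and a·M = M·a for all a ∈ ℓ¹(ℕ,∨). Consequently ℓ¹(ℕ, ∨) is not super-amenable, even though it has an identity. -/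
open scoped BigOperators

variable {R A X : Type*} [NormedRing R] [NormedAlgebra ℂ R]
  [NormedRing A] [NormedAlgebra ℂ A] [NormedAddCommGroup X] [NormedSpace ℂ X]

theorem aux_tendsto {E : Type*} [NormedAddCommGroup E] [NormedSpace ℂ E] (S : Set E)
    (hS : Dense ((Submodule.span ℂ S : Submodule ℂ E) : Set E))
    (f : ℕ+ → E →L[ℂ] ℂ) (g : E →L[ℂ] ℂ) (hf : ∀ n, ‖f n‖ ≤ 1) (hg : ‖g‖ ≤ 1)
    (h : ∀ x ∈ S, Filter.Tendsto (fun n => f n x) Filter.atTop (nhds (g x))) (x : E) :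
    Filter.Tendsto (fun n => f n x) Filter.atTop (nhds (g x)) := by
  have h1 : ∀ y ∈ Submodule.span ℂ S,
      Filter.Tendsto (fun n => f n y) Filter.atTop (nhds (g y)) := by
    intro y hy
    induction hy using Submodule.span_induction with
    | mem x hx => exact h x hx
    | zero => simp
    | add x y _ _ hx hy => simpa using hx.add hy
    | smul c x _ hx => simpa using hx.const_mul c
  rw [Metric.tendsto_atTop]
  intro ε hε
  obtain ⟨y, hy, hxy⟩ := Metric.dense_iff.1 hS x (ε / 3) (by positivity)
  obtain ⟨N, hN⟩ := Metric.tendsto_atTop.1 (h1 y hxy) (ε / 3) (by positivity)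
  refine ⟨N, fun n hn => ?_⟩
  have h2 := hN n hn
  rw [dist_eq_norm] at h2 ⊢
  have hy' : ‖y - x‖ < ε / 3 := by simpa [dist_eq_norm] using hy
  have e : f n x - g x = (f n y - g y) - f n (y - x) + g (y - x) := by
    simp only [map_sub]; ring
  have b1 : ‖f n (y - x)‖ ≤ 1 * ‖y - x‖ := (f n).le_of_opNorm_le (hf n) _
  have b2 : ‖g (y - x)‖ ≤ 1 * ‖y - x‖ := g.le_of_opNorm_le hg _
  rw [e]
  have t1 := norm_add_le ((f n y - g y) - f n (y - x)) (g (y - x))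
  have t2 := norm_sub_le (f n y - g y) (f n (y - x))
  linarith

theorem aux_char (A : Type*) [NormedRing A] [NormedAlgebra ℂ A]
    (δ : ℕ+ → A)
    (hmul : ∀ m n : ℕ+, δ m * δ n = δ (max m n))
    (hnorm : ∀ c : ℕ+ →₀ ℂ, ‖c.sum fun s z => z • δ s‖ = ∑ s ∈ c.support, ‖c s‖)
    (hdense : Dense ((Submodule.span ℂ (Set.range δ) : Submodule ℂ A) : Set A))
    (χ : ℕ+ → ℂ) (hχ : ∀ n, ‖χ n‖ ≤ 1) (hχm : ∀ m n, χ (max m n) = χ m * χ n) :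
    ∃ φ : A →L[ℂ] ℂ, (∀ n, φ (δ n) = χ n) ∧ (∀ a b, φ (a * b) = φ a * φ b) ∧ ‖φ‖ ≤ 1 := by
  have hd : DenseRange (Finsupp.linearCombination ℂ δ) := by
    rw [DenseRange, ← LinearMap.coe_range, Finsupp.range_linearCombination]
    exact hdense
  have hb : ∀ c : ℕ+ →₀ ℂ, ‖Finsupp.linearCombination ℂ χ c‖ ≤
      1 * ‖Finsupp.linearCombination ℂ δ c‖ := by
    intro c
    rw [Finsupp.linearCombination_apply, Finsupp.linearCombination_apply, hnorm, one_mul]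
    refine (norm_sum_le _ _).trans (Finset.sum_le_sum fun i _ => ?_)
    rw [norm_smul]
    exact mul_le_of_le_one_right (norm_nonneg _) (hχ i)
  let φ : A →L[ℂ] ℂ := (Finsupp.linearCombination ℂ χ).extendOfNorm (Finsupp.linearCombination ℂ δ)
  have hφ : ∀ n, φ (δ n) = χ n := by
    intro n
    have := LinearMap.extendOfNorm_eq hd ⟨1, hb⟩ (Finsupp.single n 1)
    simpa using this
  refine ⟨φ, hφ, ?_, LinearMap.opNorm_extendOfNorm_le hd zero_le_one hb⟩
  have step : ∀ n b, φ (δ n * b) = φ (δ n) * φ b := by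
    intro n
    have : φ.comp (ContinuousLinearMap.mul ℂ A (δ n)) = φ (δ n) • φ := by
      refine ContinuousLinearMap.ext_on hdense ?_
      rintro _ ⟨m, rfl⟩
      simp [hmul, hφ, hχm]
    intro b
    simpa using DFunLike.congr_fun this b
  intro a b
  have : φ.comp ((ContinuousLinearMap.mul ℂ A).flip b) = φ b • φ := by
    refine ContinuousLinearMap.ext_on hdense ?_
    rintro _ ⟨m, rfl⟩
    simp [step, mul_comm]
  simpa [mul_comm] using DFunLike.congr_fun this a

theorem aux_dense {T : Type} [NormedAddCommGroup T] [NormedSpace ℂ T] [CompleteSpace T] (S : Set T)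
    (h : ∀ (Y : Type) [NormedAddCommGroup Y] [NormedSpace ℂ Y] [CompleteSpace Y]
      (g₁ g₂ : T →L[ℂ] Y), (∀ a ∈ S, g₁ a = g₂ a) → g₁ = g₂) :
    Dense ((Submodule.span ℂ S : Submodule ℂ T) : Set T) := by
  intro x
  let W := (Submodule.span ℂ S).topologicalClosure
  have hW : IsClosed (W : Set T) := Submodule.isClosed_topologicalClosure _
  haveI : IsClosed (W : Set T) := hW
  have h1 := h (T ⧸ W) W.mkQL 0 (by
    intro a ha
    have : a ∈ W := Submodule.le_topologicalClosure _ (Submodule.subset_span ha)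
    simpa using this)
  have h2 := DFunLike.congr_fun h1 x
  have : x ∈ W := by simpa using h2
  exact this

theorem aux_no_diag
    (A : Type*) [NormedRing A] [NormedAlgebra ℂ A]
    (δ : ℕ+ → A)
    (hmul : ∀ m n : ℕ+, δ m * δ n = δ (max m n))
    (hnorm : ∀ c : ℕ+ →₀ ℂ, ‖c.sum fun s z => z • δ s‖ = ∑ s ∈ c.support, ‖c s‖)
    (hdense : Dense ((Submodule.span ℂ (Set.range δ) : Submodule ℂ A) : Set A))
    (T : Type) [NormedRing T] [NormedAlgebra ℂ T]
    (ι : A →L[ℂ] A →L[ℂ] T) (hT : IsProjTensorSq A T ι)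
    (hTd : Dense ((Submodule.span ℂ {t : T | ∃ a b, ι a b = t} : Submodule ℂ T) : Set T))
    (ω : T →L[ℂ] A) (hω : ∀ a b : A, ω (ι a b) = a * b)
    (Lact Ract : A →L[ℂ] T →L[ℂ] T)
    (hL : ∀ a b c : A, Lact a (ι b c) = ι (a * b) c)
    (hR : ∀ a b c : A, Ract a (ι b c) = ι b (c * a)) (M : T) (h1 : ∀ a : A, a * ω M = a)
    (h2 : ∀ a : A, Lact a M = Ract a M) : False := by
  obtain ⟨φ, hφ, hφm, hφn⟩ := aux_char A δ hmul hnorm hdense (fun _ => 1) (by simp) (by simp)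
  have hex : ∀ n : ℕ+, _ := fun n => aux_char A δ hmul hnorm hdense
    (fun m => if m ≤ n then 1 else 0) (by intro m; split_ifs <;> simp)
    (by intro m k; simp only [max_le_iff]; split_ifs <;> simp_all)
  choose ψ hψ hψm hψn using hex
  have hB : ∀ (f : A →L[ℂ] ℂ), ‖f‖ ≤ 1 →
      ∃ g : T →L[ℂ] ℂ, (∀ a b, g (ι a b) = f a * φ b) ∧ ‖g‖ ≤ 1 := by
    intro f hf
    obtain ⟨g, hg, hgn⟩ := hT.lift ℂ (f.smulRight φ)
    refine ⟨g, fun a b => by simp [hg], hgn.trans ?_⟩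
    rw [ContinuousLinearMap.norm_smulRight_apply]
    exact mul_le_one₀ hf (norm_nonneg _) hφn
  obtain ⟨g, hg, hgn⟩ := hB φ hφn
  choose G hG hGn using fun n => hB (ψ n) (hψn n)
  have hconv : ∀ a, Filter.Tendsto (fun n => ψ n a) Filter.atTop (nhds (φ a)) := by
    refine aux_tendsto (Set.range δ) hdense ψ φ hψn hφn ?_
    rintro _ ⟨m, rfl⟩
    rw [hφ]
    refine tendsto_const_nhds.congr' ?_
    filter_upwards [Filter.eventually_ge_atTop m] with n hn
    simp [hψ, hn]
  have hconvT : Filter.Tendsto (fun n => G n M) Filter.atTop (nhds (g M)) := by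
    refine aux_tendsto _ hTd G g hGn hgn ?_ M
    rintro _ ⟨a, b, rfl⟩
    simp only [hG, hg]
    exact (hconv a).mul_const _
  have hGM : ∀ n, G n M = 0 := by
    intro n
    have e1 : (G n).comp (Lact (δ (n + 1))) = 0 := by
      refine ContinuousLinearMap.ext_on hTd ?_
      rintro _ ⟨a, b, rfl⟩
      have : ¬ (n + 1 ≤ n) := not_le.2 (PNat.lt_add_right n 1)
      simp [hL, hG, hψm, hψ, this]
    have e2 : (G n).comp (Ract (δ (n + 1))) = G n := by
      refine ContinuousLinearMap.ext_on hTd ?_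
      rintro _ ⟨a, b, rfl⟩
      simp [hR, hG, hφm, hφ]
    have e1' := DFunLike.congr_fun e1 M
    have e2' := DFunLike.congr_fun e2 M
    simp only [ContinuousLinearMap.comp_apply] at e1' e2'
    rw [← e2', ← h2, e1']
    rfl
  have hgM : g M = 1 := by
    have e : φ.comp ω = g := by
      refine ContinuousLinearMap.ext_on hTd ?_
      rintro _ ⟨a, b, rfl⟩
      simp [hω, hg, hφm]
    rw [← e]
    have := congrArg φ (h1 (δ 1))
    rw [hφm, hφ] at this
    simpa using this
  simp only [hGM, hgM] at hconvT
  exact zero_ne_one (tendsto_nhds_unique tendsto_const_nhds hconvT)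

theorem aux_diag_of_superAmenable
    (A : Type*) [NormedRing A] [NormedAlgebra ℂ A]
    (T : Type) [NormedRing T] [NormedAlgebra ℂ T] [CompleteSpace T]
    (ι : A →L[ℂ] A →L[ℂ] T)
    (hTd : Dense ((Submodule.span ℂ {t : T | ∃ a b, ι a b = t} : Submodule ℂ T) : Set T))
    (ω : T →L[ℂ] A) (hω : ∀ a b : A, ω (ι a b) = a * b)
    (Lact Ract : A →L[ℂ] T →L[ℂ] T)
    (hL : ∀ a b c : A, Lact a (ι b c) = ι (a * b) c)
    (hR : ∀ a b c : A, Ract a (ι b c) = ι b (c * a))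
    (e : A) (he1 : ∀ a, e * a = a) (he2 : ∀ a, a * e = a) (hS : SuperAmenable A) :
    ∃ M : T, (∀ a : A, a * ω M = a) ∧ ∀ a : A, Lact a M = Ract a M := by
  have hωL : ∀ a t, ω (Lact a t) = a * ω t := by
    intro a
    have : ω.comp (Lact a) = (ContinuousLinearMap.mul ℂ A a).comp ω := by
      refine ContinuousLinearMap.ext_on hTd ?_
      rintro _ ⟨b, c, rfl⟩
      simp [hL, hω, mul_assoc]
    exact fun t => DFunLike.congr_fun this t
  have hωR : ∀ a t, ω (Ract a t) = ω t * a := by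
    intro a
    have : ω.comp (Ract a) = ((ContinuousLinearMap.mul ℂ A).flip a).comp ω := by
      refine ContinuousLinearMap.ext_on hTd ?_
      rintro _ ⟨b, c, rfl⟩
      simp [hR, hω, mul_assoc]
    exact fun t => DFunLike.congr_fun this t
  have hLL : ∀ a b t, Lact (a * b) t = Lact a (Lact b t) := by
    intro a b
    have : Lact (a * b) = (Lact a).comp (Lact b) := by
      refine ContinuousLinearMap.ext_on hTd ?_
      rintro _ ⟨b, c, rfl⟩
      simp [hL, mul_assoc]
    exact fun t => DFunLike.congr_fun this t
  have hRR : ∀ a b t, Ract b (Ract a t) = Ract (a * b) t := by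
    intro a b
    have : (Ract b).comp (Ract a) = Ract (a * b) := by
      refine ContinuousLinearMap.ext_on hTd ?_
      rintro _ ⟨b, c, rfl⟩
      simp [hR, mul_assoc]
    exact fun t => DFunLike.congr_fun this t
  have hLR : ∀ a b t, Ract b (Lact a t) = Lact a (Ract b t) := by
    intro a b
    have : (Ract b).comp (Lact a) = (Lact a).comp (Ract b) := by
      refine ContinuousLinearMap.ext_on hTd ?_
      rintro _ ⟨b, c, rfl⟩
      simp [hL, hR]
    exact fun t => DFunLike.congr_fun this t
  let K : Submodule ℂ T := LinearMap.ker (ω : T →ₗ[ℂ] A)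
  have hK : ∀ t, t ∈ K ↔ ω t = 0 := fun t => Iff.rfl
  have hKc : IsClosed (K : Set T) := ω.isClosed_ker
  haveI : CompleteSpace K := hKc.completeSpace_coe
  let al : A →L[ℂ] K →L[ℂ] K := LinearMap.mkContinuous₂
    (LinearMap.mk₂ ℂ (fun a (k : K) => (⟨Lact a k, by
        rw [hK, hωL, (hK _).1 k.2, mul_zero]⟩ : K))
      (by intros; ext; simp) (by intros; ext; simp) (by intros; ext; simp)
      (by intros; ext; simp)) ‖Lact‖ (fun a k => Lact.le_opNorm₂ a k)
  let ar : A →L[ℂ] K →L[ℂ] K := LinearMap.mkContinuous₂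
    (LinearMap.mk₂ ℂ (fun a (k : K) => (⟨Ract a k, by
        rw [hK, hωR, (hK _).1 k.2, zero_mul]⟩ : K))
      (by intros; ext; simp) (by intros; ext; simp) (by intros; ext; simp)
      (by intros; ext; simp)) ‖Ract‖ (fun a k => Ract.le_opNorm₂ a k)
  have hal : ∀ a k, ((al a k : K) : T) = Lact a k := fun a k => rfl
  have har : ∀ a k, ((ar a k : K) : T) = Ract a k := fun a k => rfl
  let D : A →L[ℂ] K := (ι.flip e - ι e).codRestrict K (by
    intro a
    rw [hK]
    simp [hω, he1, he2])
  have hD : ∀ a, ((D a : K) : T) = ι a e - ι e a := fun a => rfl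
  obtain ⟨x, hx⟩ := hS K al ar
    (fun a b x => Subtype.ext (by simp only [hal, hLL]))
    (fun a b x => Subtype.ext (by simp only [har, hRR]))
    (fun a b x => Subtype.ext (by simp only [hal, har, hLR]))
    D (fun a b => Subtype.ext (by
      simp only [Submodule.coe_add, hal, har, hD, map_sub, hL, hR, he1, he2]
      abel))
  refine ⟨ι e e - x, fun a => ?_, fun a => ?_⟩
  · rw [map_sub, (hK _).1 x.2, hω, he2, sub_zero, he2]
  · have := congrArg (Subtype.val) (hx a)
    rw [hD, Submodule.coe_sub, hal, har] at this
    rw [map_sub, map_sub, hL, hR, he1, he2]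
    rw [sub_eq_sub_iff_add_eq_add] at this ⊢
    rw [this]
    abel

/-- `ℓ¹(ℕ⁺, ∨)` has no diagonal, hence is not super-amenable, even though it
has an identity. -/
theorem l1_nat_max_not_superAmenable
    (A : Type*) [NormedRing A] [NormedAlgebra ℂ A] [CompleteSpace A]
    -- `A` is `ℓ¹(ℕ⁺, ∨)`
    (δ : ℕ+ → A)
    (hmul : ∀ m n : ℕ+, δ m * δ n = δ (max m n))
    (hnorm : ∀ c : ℕ+ →₀ ℂ, ‖c.sum fun s z => z • δ s‖ = ∑ s ∈ c.support, ‖c s‖)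
    (hdense : Dense ((Submodule.span ℂ (Set.range δ) : Submodule ℂ A) : Set A))
    -- `T` is a realization of the projective tensor product `A ⊗̂ A`
    (T : Type) [NormedRing T] [NormedAlgebra ℂ T] [CompleteSpace T]
    (ι : A →L[ℂ] A →L[ℂ] T) (hT : IsProjTensorSq A T ι)
    (ω : T →L[ℂ] A) (hω : ∀ a b : A, ω (ι a b) = a * b)
    -- the canonical `A`-actions on `A ⊗̂ A`
    (Lact Ract : A →L[ℂ] T →L[ℂ] T)
    (hL : ∀ a b c : A, Lact a (ι b c) = ι (a * b) c)
    (hR : ∀ a b c : A, Ract a (ι b c) = ι b (c * a)) :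
    (¬ ∃ M : T, (∀ a : A, a * ω M = a) ∧ ∀ a : A, Lact a M = Ract a M) ∧
    ¬ SuperAmenable A ∧ ∃ e : A, ∀ a : A, e * a = a ∧ a * e = a := by
  have hTd : Dense ((Submodule.span ℂ {t : T | ∃ a b, ι a b = t} : Submodule ℂ T) : Set T) := by
    refine aux_dense _ ?_
    intro Y _ _ _ g₁ g₂ h
    exact hT.lift_unique Y g₁ g₂ (fun a b => h _ ⟨a, b, rfl⟩)
  have he1 : ∀ a, δ 1 * a = a := by
    have : ContinuousLinearMap.mul ℂ A (δ 1) = ContinuousLinearMap.id ℂ A := by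
      refine ContinuousLinearMap.ext_on hdense ?_
      rintro _ ⟨m, rfl⟩
      simp [hmul]
    exact fun a => DFunLike.congr_fun this a
  have he2 : ∀ a, a * δ 1 = a := by
    have : (ContinuousLinearMap.mul ℂ A).flip (δ 1) = ContinuousLinearMap.id ℂ A := by
      refine ContinuousLinearMap.ext_on hdense ?_
      rintro _ ⟨m, rfl⟩
      simp [hmul]
    exact fun a => DFunLike.congr_fun this a
  have key : ¬ ∃ M : T, (∀ a : A, a * ω M = a) ∧ ∀ a : A, Lact a M = Ract a M := by
    rintro ⟨M, h1, h2⟩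
    exact aux_no_diag A δ hmul hnorm hdense T ι hT hTd ω hω Lact Ract hL hR M h1 h2
  exact ⟨key, fun hS => key (aux_diag_of_superAmenable A T ι hTd ω hω Lact Ract hL hR
    (δ 1) he1 he2 hS), δ 1, fun a => ⟨he1 a, he2 a⟩⟩
end
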